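/- arXiv:math/0603191 — 2 statements merged into one kernel-verified Lean document; each statement's English description precedes it below -/
import Mathlib

section
/- The dihedral group D₈ of order 8 satisfies H³(D₈, ℂˣ) ≅ (ℤ/2)² ⊕ ℤ/4; in particular |H³(D₈, ℂˣ)| = 16. -/
/-- The subgroup of 3-cocycles in the group of `ℂˣ`-valued 3-cochains on `G`
(inhomogeneous bar resolution). -/
def cocycles3 (G : Type*) [Group G] : Subgroup (G → G → G → ℂˣ) where
  carrier := {ω | ∀ g h k l,
    ω g h k * ω g (h * k) l * ω h k l = ω (g * h) k l * ω g h (k * l)}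
  one_mem' := by intro g h k l; simp
  mul_mem' := by
    intro a b ha hb g h k l
    simp only [Pi.mul_apply]
    rw [mul_mul_mul_comm (a g h k) (b g h k) (a g (h * k) l) (b g (h * k) l),
      mul_mul_mul_comm (a g h k * a g (h * k) l) (b g h k * b g (h * k) l)
        (a h k l) (b h k l),
      ha g h k l, hb g h k l, mul_mul_mul_comm]
  inv_mem' := by
    intro a ha g h k l
    simp only [Pi.inv_apply, ← mul_inv]
    rw [ha g h k l]

/-- The subgroup of 3-coboundaries. -/
def coboundaries3 (G : Type*) [Group G] : Subgroup (G → G → G → ℂˣ) where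
  carrier := {ω | ∃ β : G → G → ℂˣ, ∀ g h k,
    ω g h k = β h k * β g (h * k) * (β (g * h) k)⁻¹ * (β g h)⁻¹}
  one_mem' := ⟨1, by simp⟩
  mul_mem' := by
    rintro a b ⟨β, hβ⟩ ⟨γ, hγ⟩
    refine ⟨β * γ, fun g h k => ?_⟩
    simp only [Pi.mul_apply, hβ g h k, hγ g h k, mul_inv]
    simp only [mul_assoc, mul_comm, mul_left_comm]
  inv_mem' := by
    rintro a ⟨β, hβ⟩
    refine ⟨β⁻¹, fun g h k => ?_⟩
    simp only [Pi.inv_apply, hβ g h k, mul_inv, inv_inv]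

instance (G : Type*) [Group G] : ((coboundaries3 G).subgroupOf (cocycles3 G)).Normal :=
  Subgroup.normal_of_comm _

/-- Third group cohomology `H³(G, ℂˣ)` (trivial action), as cocycles modulo
coboundaries. -/
def H3 (G : Type*) [Group G] :=
  cocycles3 G ⧸ (coboundaries3 G).subgroupOf (cocycles3 G)

noncomputable instance (G : Type*) [Group G] : Group (H3 G) :=
  inferInstanceAs (Group (cocycles3 G ⧸ (coboundaries3 G).subgroupOf (cocycles3 G)))

open CategoryTheory

theorem finite_and_card_le_of_exact {A B C : Type*} [AddCommGroup A] [AddCommGroup B]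
    [AddCommGroup C] [Finite A] [Finite C] (f : A →+ B) (g : B →+ C)
    (h : Function.Exact f g) : Finite B ∧ Nat.card B ≤ Nat.card A * Nat.card C := by
  have hf : Finite f.range := Finite.of_surjective _ f.rangeRestrict_surjective
  have hker : Finite g.ker := by rwa [h.addMonoidHom_ker_eq]
  have hquot : Finite (B ⧸ g.ker) := .of_equiv _
    (QuotientAddGroup.quotientKerEquivRange g).symm.toEquiv
  refine ⟨.of_addSubgroup_quotient (H := g.ker), ?_⟩
  rw [g.ker.card_eq_card_quotient_mul_card_addSubgroup,
    Nat.card_congr (QuotientAddGroup.quotientKerEquivRange g).toEquiv, h.addMonoidHom_ker_eq,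
    mul_comm]
  exact Nat.mul_le_mul (Nat.card_le_card_of_surjective _ f.rangeRestrict_surjective)
    (Nat.card_le_card_of_injective _ Subtype.val_injective)

namespace Rep

theorem exact_of_forall_exists {k G : Type} [CommRing k] [Group G] (X : ShortComplex (Rep.{0} k G))
    (h : ∀ x : X.X₂, X.g.hom x = 0 → ∃ y : X.X₁, X.f.hom y = x) : X.Exact := by
  rw [← ShortComplex.exact_map_iff_of_faithful _ (forget₂ (Rep k G) (ModuleCat k)),
    ShortComplex.moduleCat_exact_iff]
  exact h

variable {G : Type} [Group G] (M : Type) [AddCommGroup M]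

/-- The `G`-module `M` on which `G` acts through the sign character `δ`. -/
noncomputable abbrev twist (δ : G →* ℤˣ) : Rep ℤ G :=
  of (k := ℤ) (G := G) (X := M)
    ((Module.toModuleEnd ℤ M : ℤ →+* _).toMonoidHom.comp ((Units.coeHom ℤ).comp δ))

instance : (twist M (1 : G →* ℤˣ)).IsTrivial where
  out g := by ext m; simp

variable (S : Subgroup G)

/-- The inclusion of a twist of `M` by a character trivial on `S` into the coinduced module. -/
noncomputable def twistToCoind (δ : G →* ℤˣ) (hδ : S ≤ δ.ker) :
    twist M δ ⟶ coind S.subtype (trivial ℤ S M) :=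
  ofHom
    { toFun := fun m => ⟨fun g => (δ g : ℤ) • m, fun s g => by
        simp [MonoidHom.mem_ker.1 (hδ s.2)]⟩
      map_add' := fun a b => by ext; simp
      map_smul' := fun a b => by ext; simp [smul_comm a]
      isIntertwining' := fun g => by
        ext m x
        change (δ x : ℤ) • (δ g : ℤ) • m = (δ (x * g) : ℤ) • m
        simp [mul_smul] }

variable {S}

theorem eq_of_ker_eq {N : Type*} {ε : G →* ℤˣ} (hε : ε.ker = S) {f : G → N}
    (hf : ∀ (s : S) (g : G), f (s * g) = f g) {a b : G} (hab : ε a = ε b) : f a = f b := by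
  have := hf ⟨a * b⁻¹, by simp [← hε, hab]⟩ b
  simpa using this

variable {M}

theorem apply_eq_of_ker_eq {ε : G →* ℤˣ} (hε : ε.ker = S)
    (f : coind S.subtype (trivial ℤ S M)) {a b : G} (hab : ε a = ε b) : f.1 a = f.1 b :=
  eq_of_ker_eq hε f.2 hab

variable (M)

/-- The quotient map from the coinduced module to a twist of `M`, where `t` is not in `S`. -/
noncomputable def coindToTwist {ε : G →* ℤˣ} (δ : G →* ℤˣ) (hε : ε.ker = S) (hδ : S ≤ δ.ker)
    {t : G} (ht : ε t = -1) :
    coind S.subtype (trivial ℤ S M) ⟶ twist M (δ * ε) :=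
  ofHom
    { toFun := fun f => f.1 1 - (δ t : ℤ) • f.1 t
      map_add' := fun a b => by simp; abel
      map_smul' := fun a b => by simp [smul_comm a, smul_sub]
      isIntertwining' := fun g => by
        ext f
        change f.1 (1 * g) - (δ t : ℤ) • f.1 (t * g) =
          ((δ g * ε g : ℤˣ) : ℤ) • (f.1 1 - (δ t : ℤ) • f.1 t)
        rcases Int.units_eq_one_or (ε g) with hg | hg
        · have hδg : δ g = 1 := hδ (hε ▸ hg)
          rw [apply_eq_of_ker_eq hε f (show ε (1 * g) = ε 1 by simp [hg]),
            apply_eq_of_ker_eq hε f (show ε (t * g) = ε t by simp [hg])]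
          simp [hg, hδg]
        · have hδg : δ g = δ t := eq_of_ker_eq hε
            (fun s x => by simp [MonoidHom.mem_ker.1 (hδ s.2)]) (hg.trans ht.symm)
          rw [apply_eq_of_ker_eq hε f (show ε (1 * g) = ε t by simp [hg, ht]),
            apply_eq_of_ker_eq hε f (show ε (t * g) = ε 1 by simp [hg, ht])]
          rcases Int.units_eq_one_or (δ t) with h | h <;> simp [hδg, hg, h, add_comm] }

/-- For a subgroup `S` of index two, the short complex `M(δ) ⟶ Coind M ⟶ M(δε)`. -/
noncomputable def twistShortComplex {ε : G →* ℤˣ} (δ : G →* ℤˣ) (hε : ε.ker = S)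
    (hδ : S ≤ δ.ker) {t : G} (ht : ε t = -1) : ShortComplex (Rep ℤ G) where
  X₁ := twist M δ
  X₂ := coind S.subtype (trivial ℤ S M)
  X₃ := twist M (δ * ε)
  f := twistToCoind M S δ hδ
  g := coindToTwist M δ hε hδ ht
  zero := by
    ext m
    change ((δ 1 : ℤˣ) : ℤ) • m - (δ t : ℤ) • (δ t : ℤ) • m = 0
    rcases Int.units_eq_one_or (δ t) with h | h <;> simp [h]

theorem twistShortComplex_shortExact {ε : G →* ℤˣ} (δ : G →* ℤˣ) (hε : ε.ker = S)
    (hδ : S ≤ δ.ker) {t : G} (ht : ε t = -1) :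
    (twistShortComplex M δ hε hδ ht).ShortExact where
  mono_f := (mono_iff_injective _).2 fun a b hab => by
    have := congrFun (congrArg Subtype.val hab) 1
    change ((δ 1 : ℤˣ) : ℤ) • a = ((δ 1 : ℤˣ) : ℤ) • b at this
    simpa using this
  epi_g := (epi_iff_surjective _).2 fun (m : M) => by
    refine ⟨⟨fun g => if ε g = 1 then m else 0, fun s g => ?_⟩, ?_⟩
    · have : ε s = 1 := by simpa [← hε] using s.2
      simp [this]
    · change (if ε 1 = 1 then m else 0) - (δ t : ℤ) • (if ε t = 1 then m else 0) = m
      simp [ht]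
  exact := by
    refine exact_of_forall_exists _ fun (f : coind S.subtype (trivial ℤ S M)) hf => ?_
    change f.1 1 - (δ t : ℤ) • f.1 t = 0 at hf
    refine ⟨f.1 1, ?_⟩
    refine Subtype.ext (funext fun g => ?_)
    change (δ g : ℤ) • f.1 1 = f.1 g
    rw [sub_eq_zero] at hf
    rcases Int.units_eq_one_or (ε g) with hg | hg
    · have hδg : δ g = 1 := hδ (hε ▸ hg)
      rw [apply_eq_of_ker_eq hε f (show ε g = ε 1 by simp [hg])]
      simp [hδg]
    · have hδg : δ g = δ t := eq_of_ker_eq hε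
        (fun s x => by simp [MonoidHom.mem_ker.1 (hδ s.2)]) (hg.trans ht.symm)
      rw [apply_eq_of_ker_eq hε f (show ε g = ε t by simp [hg, ht]), hδg, hf]
      rcases Int.units_eq_one_or (δ t) with h | h <;> simp [h]

end Rep

namespace groupCohomology

open Rep

variable {G : Type} [Group G] {M : Type} [AddCommGroup M] {S : Subgroup G} {ε : G →* ℤˣ}

theorem finite_and_card_succ_le {X : ShortComplex (Rep ℤ G)} (hX : X.ShortExact) (n : ℕ)
    [Finite (groupCohomology X.X₃ n)] [Finite (groupCohomology X.X₂ (n + 1))] :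
    Finite (groupCohomology X.X₁ (n + 1)) ∧ Nat.card (groupCohomology X.X₁ (n + 1)) ≤
      Nat.card (groupCohomology X.X₃ n) * Nat.card (groupCohomology X.X₂ (n + 1)) :=
  finite_and_card_le_of_exact
    (mapShortComplex₁ hX rfl).f.hom.toAddMonoidHom (mapShortComplex₁ hX rfl).g.hom.toAddMonoidHom
    ((ShortComplex.ShortExact.moduleCat_exact_iff_function_exact _).1
      (mapShortComplex₁_exact hX rfl))

variable (M)

theorem subsingleton_even_of_isCyclic {C : Type} [Group C] [IsCyclic C] [Fintype C]
    (hM : ∀ m : M, ∃ m', Fintype.card C • m' = m) (n : ℕ) [NeZero n] (hn : Even n) :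
    Subsingleton (groupCohomology (trivial ℤ C M) n) := by
  let : CommGroup C := IsCyclic.commGroup
  obtain ⟨g, hg⟩ := IsCyclic.exists_generator (α := C)
  refine subsingleton_of_forall_eq 0 fun x => ?_
  obtain ⟨y, rfl⟩ := (ModuleCat.epi_iff_surjective
    (FiniteCyclicGroup.groupCohomologyπEven (trivial ℤ C M) g hg n hn)).1
    (epi_comp' (@IsIso.epi_of_iso _ _ _ _ _ (Iso.isIso_inv _))
      (epi_comp' inferInstance inferInstance)) x
  rw [FiniteCyclicGroup.groupCohomologyπEven_eq_zero_iff]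
  obtain ⟨m, hm⟩ := hM y.1
  refine ⟨m, ?_⟩
  rw [← hm]
  simp [Rep.norm, Representation.norm]

theorem finite_and_card_odd_le_of_isCyclic {C : Type} [Group C] [IsCyclic C] [Fintype C]
    [Finite {m : M // Fintype.card C • m = 0}] (n : ℕ) (hn : Odd n) :
    Finite (groupCohomology (trivial ℤ C M) n) ∧
      Nat.card (groupCohomology (trivial ℤ C M) n) ≤
        Nat.card {m : M // Fintype.card C • m = 0} := by
  let : CommGroup C := IsCyclic.commGroup
  obtain ⟨g, hg⟩ := IsCyclic.exists_generator (α := C)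
  have hs := (ModuleCat.epi_iff_surjective
    (FiniteCyclicGroup.groupCohomologyπOdd (trivial ℤ C M) g hg n hn)).1
    (epi_comp' (@IsIso.epi_of_iso _ _ _ _ _ (Iso.isIso_inv _))
      (epi_comp' inferInstance inferInstance))
  let e : {m : M // Fintype.card C • m = 0} ≃
      LinearMap.ker (trivial ℤ C M).norm.hom.toLinearMap :=
    Equiv.subtypeEquivRight fun m => by
      simp [Rep.norm, Representation.norm]
  have hs' := hs.comp e.surjective
  exact ⟨.of_surjective _ hs', Nat.card_le_card_of_surjective _ hs'⟩

variable {M} in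
theorem finite_and_card_twist_succ_le {δ δ' : G →* ℤˣ} (hε : ε.ker = S) (hδ : S ≤ δ.ker) {t : G}
    (ht : ε t = -1) (hδ' : δ * ε = δ') (n : ℕ) [Finite (groupCohomology (twist M δ') n)]
    [Finite (groupCohomology (trivial ℤ S M) (n + 1))] :
    Finite (groupCohomology (twist M δ) (n + 1)) ∧ Nat.card (groupCohomology (twist M δ) (n + 1)) ≤
      Nat.card (groupCohomology (twist M δ') n) *
        Nat.card (groupCohomology (trivial ℤ S M) (n + 1)) := by
  subst hδ'
  have e := (coindIso (trivial ℤ S M) (n + 1)).toLinearEquiv.toEquiv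
  have : Finite (groupCohomology (twistShortComplex M δ hε hδ ht).X₂ (n + 1)) := .of_equiv _ e.symm
  have : Finite (groupCohomology (twistShortComplex M δ hε hδ ht).X₃ n) := ‹_›
  rw [← Nat.card_congr e]
  exact finite_and_card_succ_le (twistShortComplex_shortExact M δ hε hδ ht) n

end groupCohomology

namespace DihedralGroup

/-- The character of a dihedral group with kernel the rotations. -/
def sign (n : ℕ) : DihedralGroup n →* ℤˣ where
  toFun
    | r _ => 1
    | sr _ => -1
  map_one' := rfl
  map_mul' := by rintro (a | a) (b | b) <;> simp

theorem sign_mul_self (n : ℕ) : sign n * sign n = 1 := by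
  ext x
  simp

theorem mem_zpowers_r_one {n : ℕ} (i : ZMod n) : r i ∈ Subgroup.zpowers (r 1 : DihedralGroup n) :=
  ⟨i.cast, by simp⟩

theorem ker_sign (n : ℕ) : (sign n).ker = Subgroup.zpowers (r 1) := by
  refine le_antisymm ?_ ((Subgroup.zpowers_le).2 rfl)
  rintro (i | i) h
  · exact mem_zpowers_r_one i
  · exact absurd (show (-1 : ℤˣ) = 1 from h) (by decide)

theorem finite_and_card_addMonoidHom_le (n : ℕ) :
    Finite (Additive (DihedralGroup n) →+ Additive ℂˣ) ∧
      Nat.card (Additive (DihedralGroup n) →+ Additive ℂˣ) ≤ 4 := by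
  have hsq (f : Additive (DihedralGroup n) →+ Additive ℂˣ) (i : ZMod n) :
      (f (.ofMul (sr i))).toMul ^ 2 = 1 := by
    have : f (.ofMul (sr i * sr i)) = 0 := by rw [sr_mul_self]; exact f.map_zero
    rw [ofMul_mul, map_add] at this
    simpa [sq] using congrArg Additive.toMul this
  let φ (f : Additive (DihedralGroup n) →+ Additive ℂˣ) : rootsOfUnity 2 ℂ × rootsOfUnity 2 ℂ :=
    (⟨_, hsq f 0⟩, ⟨_, hsq f 1⟩)
  have hφ : Function.Injective φ := fun f g h => by
    have h0 : f (.ofMul (sr 0)) = g (.ofMul (sr 0)) := congrArg Subtype.val (congrArg Prod.fst h)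
    have h1 : f (.ofMul (sr 1)) = g (.ofMul (sr 1)) := congrArg Subtype.val (congrArg Prod.snd h)
    have hr : f (.ofMul (r 1)) = g (.ofMul (r 1)) := by
      have : (r 1 : DihedralGroup n) = sr 0 * sr 1 := by simp
      rw [this, ofMul_mul, map_add, map_add, h0, h1]
    have hr' (i : ZMod n) : f (.ofMul (r i)) = g (.ofMul (r i)) := by
      have : (r i : DihedralGroup n) = r 1 ^ (i.cast : ℤ) := by simp
      rw [this, ofMul_zpow, map_zsmul, map_zsmul, hr]
    refine AddMonoidHom.ext ?_
    rintro (i | i)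
    · exact hr' i
    · have : (sr i : DihedralGroup n) = sr 0 * r i := by simp
      change f (.ofMul (sr i)) = g (.ofMul (sr i))
      rw [this, ofMul_mul, map_add, map_add, h0, hr']
  refine ⟨.of_injective φ hφ, (Nat.card_le_card_of_injective φ hφ).trans ?_⟩
  rw [Nat.card_prod, Complex.card_rootsOfUnity]

theorem exists_nsmul_eq {n : ℕ} (hn : n ≠ 0) (z : Additive ℂˣ) : ∃ w, n • w = z := by
  obtain ⟨w, hw⟩ := IsAlgClosed.exists_pow_nat_eq (z.toMul : ℂ) (Nat.pos_of_ne_zero hn)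
  refine ⟨.ofMul (Units.mk0 w ?_), congrArg Additive.ofMul (Units.ext hw)⟩
  rintro rfl
  simp [hn] at hw
  exact absurd hw.symm z.toMul.ne_zero

theorem finite_and_card_torsion_le (n : ℕ) [NeZero n] :
    Finite {z : Additive ℂˣ // n • z = 0} ∧ Nat.card {z : Additive ℂˣ // n • z = 0} ≤ n := by
  have e : {z : Additive ℂˣ // n • z = 0} ≃ rootsOfUnity n ℂ :=
    Equiv.subtypeEquiv Additive.toMul fun z => Iff.rfl
  exact ⟨.of_equiv _ e.symm, by rw [Nat.card_congr e, Complex.card_rootsOfUnity]⟩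

open groupCohomology Rep

theorem finite_and_card_groupCohomology_three_le :
    Finite (groupCohomology (twist (Additive ℂˣ) (1 : DihedralGroup 4 →* ℤˣ)) 3) ∧
      Nat.card (groupCohomology (twist (Additive ℂˣ) (1 : DihedralGroup 4 →* ℤˣ)) 3) ≤ 16 := by
  have : Fintype (Subgroup.zpowers (r 1 : DihedralGroup 4)) := Fintype.ofFinite _
  have hS : Fintype.card (Subgroup.zpowers (r 1 : DihedralGroup 4)) = 4 := by
    rw [← Nat.card_eq_fintype_card, Nat.card_zpowers, orderOf_r_one]
  have h2 : Subsingleton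
      (groupCohomology (trivial ℤ (Subgroup.zpowers (r 1 : DihedralGroup 4)) (Additive ℂˣ)) 2) :=
    subsingleton_even_of_isCyclic _ (fun m => exists_nsmul_eq (by simp [hS]) m) 2 even_two
  have ht := finite_and_card_torsion_le 4
  rw [← hS] at ht
  have := ht.1
  have ⟨h3, h3'⟩ := finite_and_card_odd_le_of_isCyclic (Additive ℂˣ)
    (C := Subgroup.zpowers (r 1 : DihedralGroup 4)) 3 (by decide)
  have ⟨h1, h1'⟩ := finite_and_card_addMonoidHom_le 4
  have e1 :=
    (H1IsoOfIsTrivial (twist (Additive ℂˣ) (1 : DihedralGroup 4 →* ℤˣ))).toLinearEquiv.toEquiv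
  have : Finite (groupCohomology (twist (Additive ℂˣ) (1 : DihedralGroup 4 →* ℤˣ)) 1) :=
    .of_equiv _ e1.symm
  have ⟨h2ε, h2ε'⟩ := finite_and_card_twist_succ_le (M := Additive ℂˣ) (ker_sign 4)
    (ker_sign 4).ge (t := sr 0) rfl (sign_mul_self 4) 1
  have ⟨h, h'⟩ := finite_and_card_twist_succ_le (M := Additive ℂˣ) (δ := 1) (ker_sign 4)
    (by simp) (t := sr 0) rfl (one_mul _) 2
  refine ⟨h, h'.trans ?_⟩
  rw [Nat.card_congr e1, Nat.card_unique (α := groupCohomology (trivial ℤ _ _) 2), mul_one] at h2ε'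
  exact Nat.mul_le_mul (h2ε'.trans h1') (h3'.trans (ht.2.trans hS.le))

end DihedralGroup

namespace groupCohomology

open Rep

theorem π_eq_zero_iff {k G : Type} [CommRing k] [Group G] (A : Rep.{0} k G) (n : ℕ)
    (z : cocycles A (n + 1)) : π A (n + 1) z = 0 ↔
      ∃ b : (Fin n → G) → A, inhomogeneousCochains.d A n b = iCocycles A (n + 1) z := by
  have hex := ShortComplex.exact_of_g_is_cokernel
    (ShortComplex.mk _ _ ((inhomogeneousCochains A).toCycles_comp_homologyπ n (n + 1)))
    ((inhomogeneousCochains A).homologyIsCokernel n (n + 1) (by simp))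
  rw [ShortComplex.moduleCat_exact_iff] at hex
  have hi : Function.Injective (iCocycles A (n + 1)) :=
    (ModuleCat.mono_iff_injective _).1 inferInstance
  have hd (b : (Fin n → G) → A) :
      iCocycles A (n + 1) ((inhomogeneousCochains A).toCycles n (n + 1) b) =
        inhomogeneousCochains.d A n b := by
    rw [← inhomogeneousCochains.d_def, ← (inhomogeneousCochains A).toCycles_i n (n + 1)]
    rfl
  constructor
  · intro hz
    obtain ⟨b, rfl⟩ := hex z hz
    exact ⟨b, (hd b).symm⟩
  · rintro ⟨b, hb⟩
    rw [← hi ((hd b).trans hb)]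
    exact ConcreteCategory.congr_hom ((inhomogeneousCochains A).toCycles_comp_homologyπ n (n + 1)) b

variable {G : Type} [Group G]

/-- A multiplicative `3`-cochain as an inhomogeneous `3`-cochain. -/
def cochain3 (ω : G → G → G → ℂˣ) (v : Fin 3 → G) : Additive ℂˣ := .ofMul (ω (v 0) (v 1) (v 2))

theorem d_cochain3 (ω : G → G → G → ℂˣ) (v : Fin 4 → G) :
    inhomogeneousCochains.d (twist (Additive ℂˣ) (1 : G →* ℤˣ)) 3 (cochain3 ω) v =
      Additive.ofMul (ω (v 1) (v 2) (v 3) * (ω (v 0 * v 1) (v 2) (v 3))⁻¹ *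
        ω (v 0) (v 1 * v 2) (v 3) * (ω (v 0) (v 1) (v 2 * v 3))⁻¹ * ω (v 0) (v 1) (v 2)) := by
  change ((1 : ℤˣ) : ℤ) • cochain3 ω (fun i => v i.succ) + ∑ j : Fin 4,
    (-1 : ℤ) ^ ((j : ℕ) + 1) • cochain3 ω (Fin.contractNth j (· * ·) v) = _
  simp [Fin.sum_univ_four, cochain3, Fin.contractNth, pow_succ]
  abel

theorem d_cochain2 (β : (Fin 2 → G) → Additive ℂˣ) (v : Fin 3 → G) :
    inhomogeneousCochains.d (twist (Additive ℂˣ) (1 : G →* ℤˣ)) 2 β v =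
      β ![v 1, v 2] - β ![v 0 * v 1, v 2] + β ![v 0, v 1 * v 2] - β ![v 0, v 1] := by
  change ((1 : ℤˣ) : ℤ) • β (fun i => v i.succ) + ∑ j : Fin 3,
    (-1 : ℤ) ^ ((j : ℕ) + 1) • β (Fin.contractNth j (· * ·) v) = _
  have h0 : (fun i : Fin 2 => v i.succ) = ![v 1, v 2] := by ext i; fin_cases i <;> rfl
  have h1 : Fin.contractNth 0 (· * ·) v = ![v 0 * v 1, v 2] := by ext i; fin_cases i <;> rfl
  have h2 : Fin.contractNth 1 (· * ·) v = ![v 0, v 1 * v 2] := by ext i; fin_cases i <;> rfl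
  have h3 : Fin.contractNth 2 (· * ·) v = ![v 0, v 1] := by ext i; fin_cases i <;> rfl
  rw [Fin.sum_univ_three, h0, h1, h2, h3]
  simp [pow_succ]
  abel

theorem mul_inv_mul_mul_inv_mul_eq_one {M : Type*} [CommGroup M] {a b c d e : M}
    (h : a * b * c = d * e) : c * d⁻¹ * b * e⁻¹ * a = 1 := by
  rw [show c * d⁻¹ * b * e⁻¹ * a = a * b * c * (d * e)⁻¹ by rw [mul_inv]; ac_rfl, h, mul_inv_cancel]

theorem toMul_sub_add_sub {M : Type*} [CommGroup M] (a b c d : Additive M) :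
    (a - b + c - d).toMul = a.toMul * c.toMul * b.toMul⁻¹ * d.toMul⁻¹ := by
  rw [toMul_sub, toMul_add, toMul_sub, div_eq_mul_inv, div_eq_mul_inv, mul_right_comm a.toMul]

theorem d_cochain3_eq_zero {ω : G → G → G → ℂˣ} (hω : ω ∈ cocycles3 G) :
    inhomogeneousCochains.d (twist (Additive ℂˣ) (1 : G →* ℤˣ)) 3 (cochain3 ω) = 0 := by
  funext v
  rw [d_cochain3]
  have h : ω (v 0) (v 1) (v 2) * ω (v 0) (v 1 * v 2) (v 3) * ω (v 1) (v 2) (v 3) =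
      ω (v 0 * v 1) (v 2) (v 3) * ω (v 0) (v 1) (v 2 * v 3) := hω _ _ _ _
  rw [mul_inv_mul_mul_inv_mul_eq_one h]
  exact (Pi.zero_apply (M := fun _ : Fin 4 → G => Additive ℂˣ) v).symm

/-- The cohomology class of a multiplicative `3`-cocycle. -/
noncomputable def ofCocycles3 (ω : cocycles3 G) :
    groupCohomology (twist (Additive ℂˣ) (1 : G →* ℤˣ)) 3 :=
  π _ 3 (cocyclesMk (cochain3 ω.1) (d_cochain3_eq_zero ω.2))

theorem ofCocycles3_inv_mul (ω ω' : cocycles3 G) :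
    ofCocycles3 (ω⁻¹ * ω') = ofCocycles3 ω' - ofCocycles3 ω := by
  rw [ofCocycles3, ofCocycles3, ofCocycles3, ← map_sub]
  congr 1
  apply (ModuleCat.mono_iff_injective (iCocycles _ 3)).1 inferInstance
  rw [map_sub, iCocycles_mk, iCocycles_mk, iCocycles_mk]
  funext v
  exact congrArg Additive.ofMul (inv_mul_eq_div (ω.1 (v 0) (v 1) (v 2)) (ω'.1 (v 0) (v 1) (v 2)))

theorem mem_coboundaries3_of_ofCocycles3_eq_zero {ω : cocycles3 G} (hω : ofCocycles3 ω = 0) :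
    ω.1 ∈ coboundaries3 G := by
  obtain ⟨b, hb⟩ := (π_eq_zero_iff _ 2 _).1 hω
  rw [iCocycles_mk] at hb
  refine ⟨fun g h => (b ![g, h] : Additive ℂˣ).toMul, fun g h k => ?_⟩
  have := (congrFun hb ![g, h, k]).symm.trans (d_cochain2 b ![g, h, k])
  exact (congrArg Additive.toMul this).trans (toMul_sub_add_sub (M := ℂˣ) _ _ _ _)

theorem finite_and_card_H3_le [Finite (groupCohomology (twist (Additive ℂˣ) (1 : G →* ℤˣ)) 3)] :
    Finite (H3 G) ∧
      Nat.card (H3 G) ≤ Nat.card (groupCohomology (twist (Additive ℂˣ) (1 : G →* ℤˣ)) 3) := by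
  let s := (coboundaries3 G).subgroupOf (cocycles3 G)
  let φ (x : cocycles3 G ⧸ s) := ofCocycles3 x.out
  have hφ : Function.Injective φ := fun x y hxy => by
    rw [← QuotientGroup.out_eq' x, ← QuotientGroup.out_eq' y, QuotientGroup.eq,
      Subgroup.mem_subgroupOf]
    refine mem_coboundaries3_of_ofCocycles3_eq_zero ?_
    rw [ofCocycles3_inv_mul, sub_eq_zero]
    exact hxy.symm
  exact ⟨.of_injective φ hφ, Nat.card_le_card_of_injective φ hφ⟩

end groupCohomology

/-- The standard primitive additive character of `ZMod n`, with values in `ℂˣ`. -/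
noncomputable def stdUnitsChar (n : ℕ) [NeZero n] : Multiplicative (ZMod n) →* ℂˣ :=
  (ZMod.stdAddChar (N := n)).toMonoidHom.toHomUnits

theorem stdUnitsChar_injective (n : ℕ) [NeZero n] : Function.Injective (stdUnitsChar n) :=
  fun _ _ h => ZMod.injective_stdAddChar (congrArg Units.val h)

section

variable {G : Type*} [Group G] {n : ℕ}

/-- The cocycle condition for a `3`-cochain of `G` with values in `ZMod n`. -/
def IsCocycle3 (e : G → G → G → ZMod n) : Prop :=
  ∀ g h k l, e g h k + e g (h * k) l + e h k l = e (g * h) k l + e g h (k * l)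

/-- The `ℂˣ`-valued cocycles obtained from the multiples of a `ZMod n`-valued one. -/
noncomputable def charCocycle [NeZero n] {e : G → G → G → ZMod n} (he : IsCocycle3 e) :
    Multiplicative (ZMod n) →* cocycles3 G where
  toFun c := ⟨fun g h k => stdUnitsChar n (.ofAdd (c.toAdd * e g h k)), fun g h k l => by
    simp only [← map_mul, ← ofAdd_add, ← mul_add, he g h k l]⟩
  map_one' := by ext; simp
  map_mul' c d := by
    ext g h k
    simp [add_mul]

/-- The product of the values `ω (g, g ^ i, g)` for `i < m`; when `g ^ m = 1`, it only depends on
the cohomology class of the cocycle `ω`. -/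
def powProd (g : G) (m : ℕ) : (G → G → G → ℂˣ) →* ℂˣ where
  toFun ω := ∏ i ∈ Finset.range m, ω g (g ^ i) g
  map_one' := by simp
  map_mul' _ _ := by simp [Finset.prod_mul_distrib]

theorem powProd_eq_one {g : G} {m : ℕ} (hg : g ^ m = 1) {ω : G → G → G → ℂˣ}
    (hω : ω ∈ coboundaries3 G) : powProd g m ω = 1 := by
  obtain ⟨β, hβ⟩ := hω
  let f (i : ℕ) := β g (g ^ i) / β (g ^ i) g
  have hf (i : ℕ) : ω g (g ^ i) g = f (i + 1) / f i := by
    simp only [hβ, f, ← pow_succ, ← pow_succ', div_eq_mul_inv, mul_inv, inv_inv]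
    simp only [mul_assoc, mul_comm, mul_left_comm]
  change ∏ i ∈ Finset.range m, ω g (g ^ i) g = 1
  simp only [hf, Finset.prod_range_div]
  simp [f, hg]

theorem powProd_charCocycle [NeZero n] {e : G → G → G → ZMod n} (he : IsCocycle3 e) (g : G)
    (m : ℕ) (c : Multiplicative (ZMod n)) : powProd g m (charCocycle he c) =
      stdUnitsChar n (.ofAdd (c.toAdd * ∑ i ∈ Finset.range m, e g (g ^ i) g)) := by
  rw [Finset.mul_sum, ofAdd_sum, map_prod]
  rfl

theorem powProd_charCocycle_of_sum_eq_zero [NeZero n] {e : G → G → G → ZMod n}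
    (he : IsCocycle3 e) {g : G} {m : ℕ} (h : ∑ i ∈ Finset.range m, e g (g ^ i) g = 0)
    (c : Multiplicative (ZMod n)) : powProd g m (charCocycle he c) = 1 := by
  rw [powProd_charCocycle, h, mul_zero, ofAdd_zero, map_one]

theorem eq_one_of_powProd_charCocycle [NeZero n] {e : G → G → G → ZMod n}
    (he : IsCocycle3 e) {g : G} {m : ℕ} (h : ∑ i ∈ Finset.range m, e g (g ^ i) g = 1)
    {c : Multiplicative (ZMod n)} (hc : powProd g m (charCocycle he c) = 1) : c = 1 := by
  rw [powProd_charCocycle, h, mul_one, ofAdd_toAdd] at hc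
  exact stdUnitsChar_injective n (hc.trans (map_one _).symm)

end

namespace DihedralGroup

/-- The homomorphism to `ZMod 2` with value `1` on `r 1` and `c` on `sr 0`. -/
def parity (c : ZMod 2) : DihedralGroup 4 → ZMod 2
  | r i => i.val
  | sr i => c + i.val

theorem parity_mul (c : ZMod 2) (g h : DihedralGroup 4) :
    parity c (g * h) = parity c g + parity c h := by
  revert c g h
  decide

/-- The cup cube of `parity c`. -/
def parityCube (c : ZMod 2) (g h k : DihedralGroup 4) : ZMod 2 :=
  parity c g * parity c h * parity c k

theorem isCocycle3_parityCube (c : ZMod 2) : IsCocycle3 (parityCube c) := by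
  intro g h k l
  simp only [parityCube, parity_mul]
  ring

/-- The exponent of the rotation part of an element. -/
def rotation : DihedralGroup 4 → ZMod 4
  | r i => i
  | sr i => i

/-- The sign by which an element acts on rotations. -/
def orientation : DihedralGroup 4 → ℤ
  | r _ => 1
  | sr _ => -1

theorem rotation_mul (g h : DihedralGroup 4) :
    rotation (g * h) = orientation h * rotation g + rotation h := by
  revert g h
  decide

theorem orientation_mul (g h : DihedralGroup 4) :
    orientation (g * h) = orientation g * orientation h := by
  rcases g with i | i <;> rcases h with j | j <;> rfl

theorem orientation_mul_self (g : DihedralGroup 4) : orientation g * orientation g = 1 := by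
  rcases g with i | i <;> rfl

/-- The Bockstein of the crossed homomorphism `rotation`. -/
def rotationBockstein (g h : DihedralGroup 4) : ZMod 4 :=
  ((orientation h * (rotation g).val + (rotation h).val - (rotation (g * h)).val) / 4 : ℤ)

set_option maxRecDepth 10000 in
theorem rotationBockstein_mul (g h k : DihedralGroup 4) :
    orientation k * rotationBockstein g h + rotationBockstein (g * h) k =
      rotationBockstein h k + rotationBockstein g (h * k) := by
  revert g h k
  decide

/-- The cup product of the crossed homomorphism `rotation` with its Bockstein. -/
def rotationCocycle (g h k : DihedralGroup 4) : ZMod 4 :=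
  orientation h * orientation k * rotation g * rotationBockstein h k

theorem isCocycle3_rotationCocycle : IsCocycle3 rotationCocycle := by
  intro g h k l
  have hl := congrArg (Int.cast : ℤ → ZMod 4) (orientation_mul_self l)
  push_cast at hl
  simp only [rotationCocycle, rotation_mul, orientation_mul, Int.cast_mul]
  linear_combination
    orientation h * orientation k * orientation l * rotation g * rotationBockstein_mul h k l -
      orientation h * orientation k * rotation g * rotationBockstein h k * hl

/-- The products of multiples of the three basic cocycles. -/
noncomputable def basicCocycle :
    Multiplicative (ZMod 2) × Multiplicative (ZMod 2) × Multiplicative (ZMod 4) →*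
      cocycles3 (DihedralGroup 4) :=
  (charCocycle (isCocycle3_parityCube 1)).coprod
    ((charCocycle (isCocycle3_parityCube 0)).coprod (charCocycle isCocycle3_rotationCocycle))

theorem eq_one_of_basicCocycle_mem
    {c : Multiplicative (ZMod 2) × Multiplicative (ZMod 2) × Multiplicative (ZMod 4)}
    (hc : (basicCocycle c : DihedralGroup 4 → _) ∈ coboundaries3 (DihedralGroup 4)) : c = 1 := by
  obtain ⟨c₁, c₂, c₃⟩ := c
  have key {g : DihedralGroup 4} {m : ℕ} (hg : g ^ m = 1) :
      powProd g m (charCocycle (isCocycle3_parityCube 1) c₁) *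
        (powProd g m (charCocycle (isCocycle3_parityCube 0) c₂) *
          powProd g m (charCocycle isCocycle3_rotationCocycle c₃)) = 1 := by
    rw [← map_mul, ← map_mul]
    exact powProd_eq_one hg hc
  have h₁ := key (g := sr 0) (m := 2) (by decide)
  have h₂ := key (g := sr 1) (m := 2) (by decide)
  have h₃ := key (g := r 1) (m := 4) (by decide)
  rw [powProd_charCocycle_of_sum_eq_zero (isCocycle3_parityCube 0) (by decide),
    powProd_charCocycle_of_sum_eq_zero isCocycle3_rotationCocycle (by decide), mul_one,
    mul_one] at h₁
  rw [powProd_charCocycle_of_sum_eq_zero (isCocycle3_parityCube 1) (by decide),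
    powProd_charCocycle_of_sum_eq_zero isCocycle3_rotationCocycle (by decide), mul_one,
    one_mul] at h₂
  rw [powProd_charCocycle_of_sum_eq_zero (isCocycle3_parityCube 1) (by decide),
    powProd_charCocycle_of_sum_eq_zero (isCocycle3_parityCube 0) (by decide), one_mul,
    one_mul] at h₃
  rw [eq_one_of_powProd_charCocycle _ (by decide) h₁,
    eq_one_of_powProd_charCocycle _ (by decide) h₂,
    eq_one_of_powProd_charCocycle _ (by decide) h₃]
  rfl

end DihedralGroup

/-- The dihedral group `D₈` of order 8 satisfies
`H³(D₈, ℂˣ) ≅ (ℤ/2)² ⊕ ℤ/4`; in particular `|H³(D₈, ℂˣ)| = 16`. -/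
theorem stmt_10 :
    Nonempty (H3 (DihedralGroup 4) ≃*
      (Multiplicative (ZMod 2) × Multiplicative (ZMod 2) × Multiplicative (ZMod 4))) ∧
    Nat.card (H3 (DihedralGroup 4)) = 16 := by
  obtain ⟨_, hle⟩ := DihedralGroup.finite_and_card_groupCohomology_three_le
  obtain ⟨_, hle'⟩ := groupCohomology.finite_and_card_H3_le (G := DihedralGroup 4)
  have hcard : Nat.card (Multiplicative (ZMod 2) × Multiplicative (ZMod 2) ×
      Multiplicative (ZMod 4)) = 16 := by
    simp
  let Ψ : _ →* H3 (DihedralGroup 4) :=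
    (QuotientGroup.mk' ((coboundaries3 (DihedralGroup 4)).subgroupOf
      (cocycles3 (DihedralGroup 4)))).comp DihedralGroup.basicCocycle
  have hΨ : Function.Injective Ψ := (injective_iff_map_eq_one Ψ).2 fun c hc =>
    DihedralGroup.eq_one_of_basicCocycle_mem
      (Subgroup.mem_subgroupOf.1 ((QuotientGroup.eq_one_iff _).1 hc))
  have e := MulEquiv.ofBijective Ψ
    (hΨ.bijective_of_nat_card_le (hcard ▸ hle'.trans hle))
  exact ⟨⟨e.symm⟩, (Nat.card_congr e.toEquiv).symm.trans hcard⟩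
end

section
/- For the dihedral group D₈, the restriction map H⁴(D₈, ℤ) → H⁴(C, ℤ) to the cyclic subgroup C of order 4 is surjective; in particular the image has order 4. -/
/-- The 4-cocycle condition for `ℤ`-valued 4-cochains (trivial action). -/
def IsCocycle4Int {G : Type*} [Group G] (f : G → G → G → G → ℤ) : Prop :=
  ∀ g h k l m,
    f h k l m - f (g * h) k l m + f g (h * k) l m - f g h (k * l) m +
      f g h k (l * m) - f g h k l = 0

open Finset in
/-- Summation of a function over `t ^ (m + N * k)` where `t ^ N = 1` splits off `k` full periods. -/
lemma sum_range_pow_add_mul {G : Type*} [Group G] {t : G} {N : ℕ} (ht : t ^ N = 1)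
    (P : G → ℤ) (m k : ℕ) :
    ∑ j ∈ range (m + N * k), P (t ^ j) =
      ∑ j ∈ range m, P (t ^ j) + k * ∑ j ∈ range N, P (t ^ j) := by
  induction k with
  | zero => simp
  | succ k ih =>
    have hper : ∑ j ∈ range (N + (m + N * k)), P (t ^ j) =
        ∑ j ∈ range N, P (t ^ j) + ∑ j ∈ range (m + N * k), P (t ^ j) := by
      rw [sum_range_add]
      simp [pow_add, ht]
    rw [show m + N * (k + 1) = N + (m + N * k) by ring, hper, ih]
    push_cast
    ring

open Finset in
lemma IsCocycle4Int.sum_range_pow {G : Type*} [Group G] {f : G → G → G → G → ℤ}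
    (hf : IsCocycle4Int f) (t d e : G) (k m : ℕ) :
    f 1 (t ^ k) d e - f (t ^ m) (t ^ k) d e +
      (∑ j ∈ range (m + k), f t (t ^ j) d e - ∑ j ∈ range k, f t (t ^ j) d e) -
      ∑ j ∈ range m, f t (t ^ j) (t ^ k * d) e + ∑ j ∈ range m, f t (t ^ j) (t ^ k) (d * e) -
      ∑ j ∈ range m, f t (t ^ j) (t ^ k) d = 0 := by
  induction m with
  | zero => simp
  | succ m ih =>
    have h := hf t (t ^ m) (t ^ k) d e
    rw [← pow_succ', ← pow_add] at h
    rw [show m + 1 + k = m + k + 1 by ring]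
    simp only [sum_range_succ]
    linarith

/-- The 2-cocycle condition for `ℤ`-valued 2-cochains (trivial action). -/
def IsCocycle2Int {G : Type*} [Group G] (φ : G → G → ℤ) : Prop :=
  ∀ g h k, φ h k - φ (g * h) k + φ g (h * k) - φ g h = 0

open Finset in
lemma IsCocycle2Int.sum_range_pow {G : Type*} [Group G] {φ : G → G → ℤ}
    (hφ : IsCocycle2Int φ) (t : G) (k m : ℕ) :
    φ 1 (t ^ k) - φ (t ^ m) (t ^ k) +
      (∑ j ∈ range (m + k), φ t (t ^ j) - ∑ j ∈ range k, φ t (t ^ j)) -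
      ∑ j ∈ range m, φ t (t ^ j) = 0 := by
  induction m with
  | zero => simp
  | succ m ih =>
    have h := hφ t (t ^ m) (t ^ k)
    rw [← pow_succ', ← pow_add] at h
    rw [show m + 1 + k = m + k + 1 by ring]
    simp only [sum_range_succ]
    linarith

section Cyclic

variable {G : Type*} [Group G] {t : G} {N : ℕ} {e : G → ℕ} {κ : G → G → ℕ}

/-- The carry function of a cyclic group is a 2-cocycle. -/
lemma isCocycle2Int_carry (hN : N ≠ 0) (hκ : ∀ a b, e a + e b = e (a * b) + N * κ a b) :
    IsCocycle2Int fun a b => (κ a b : ℤ) := by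
  intro a b c
  have h₁ := hκ b c
  have h₂ := hκ (a * b) c
  have h₃ := hκ a (b * c)
  have h₄ := hκ a b
  rw [mul_assoc] at h₂
  zify at h₁ h₂ h₃ h₄
  refine (mul_eq_zero.mp ?_).resolve_left (Nat.cast_ne_zero.mpr hN : (N : ℤ) ≠ 0)
  linear_combination h₂ - h₁ - h₃ + h₄

open Finset in
/-- Every 2-cocycle on a cyclic group is cohomologous to a multiple of the carry cocycle. -/
lemma IsCocycle2Int.exists_eq_carry (ht : t ^ N = 1) (he : ∀ a, t ^ e a = a)
    (hκ : ∀ a b, e a + e b = e (a * b) + N * κ a b)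
    {φ : G → G → ℤ} (hφ : IsCocycle2Int φ) :
    ∃ (n : ℤ) (ψ : G → ℤ), ∀ a b, φ a b = κ a b * n + (ψ b - ψ (a * b) + ψ a) := by
  refine ⟨∑ j ∈ range N, φ t (t ^ j), fun a => φ 1 1 - ∑ j ∈ range (e a), φ t (t ^ j), ?_⟩
  intro a b
  have h := hφ.sum_range_pow t (e b) (e a)
  have h₁ := hφ 1 1 b
  rw [hκ, sum_range_pow_add_mul ht (φ t), he, he] at h
  simp only [one_mul] at h₁
  linarith

open Finset in
/-- Periodicity: every 4-cocycle on a cyclic group is cohomologous to the cup product of the carry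
cocycle with a 2-cocycle. -/
lemma IsCocycle4Int.exists_eq_carry_mul (ht : t ^ N = 1) (he : ∀ a, t ^ e a = a)
    (hκ : ∀ a b, e a + e b = e (a * b) + N * κ a b)
    {f : G → G → G → G → ℤ} (hf : IsCocycle4Int f) :
    ∃ (φ : G → G → ℤ) (β : G → G → G → ℤ), IsCocycle2Int φ ∧ ∀ a b c d,
      f a b c d = κ a b * φ c d +
        (β b c d - β (a * b) c d + β a (b * c) d - β a b (c * d) + β a b c) := by
  refine ⟨fun c d => ∑ j ∈ range N, f t (t ^ j) c d,
    fun a b c => f 1 1 b c - ∑ j ∈ range (e a), f t (t ^ j) b c, ?_, ?_⟩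
  · intro a b c
    have h := hf.sum_range_pow t b c (e a) N
    have hs := sum_range_pow_add_mul ht (fun x => f t x b c) (e a) 1
    rw [mul_one, Nat.cast_one, one_mul, add_comm (e a)] at hs
    rw [hs, ht, he] at h
    linarith
  · intro a b c d
    have h := hf.sum_range_pow t c d (e b) (e a)
    rw [hκ, sum_range_pow_add_mul ht (fun x => f t x c d), he, he] at h
    have h₁ := hf 1 1 b c d
    simp only [one_mul] at h₁
    linarith

/-- Every 4-cocycle on a cyclic group is cohomologous to a multiple of the cup square of the carry
cocycle. -/
lemma IsCocycle4Int.exists_eq_carry_mul_carry (hN : N ≠ 0) (ht : t ^ N = 1)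
    (he : ∀ a, t ^ e a = a) (hκ : ∀ a b, e a + e b = e (a * b) + N * κ a b)
    {f : G → G → G → G → ℤ} (hf : IsCocycle4Int f) :
    ∃ (n : ℤ) (β : G → G → G → ℤ), ∀ a b c d,
      f a b c d = n * (κ a b * κ c d) +
        (β b c d - β (a * b) c d + β a (b * c) d - β a b (c * d) + β a b c) := by
  obtain ⟨φ, β, hφ, hβ⟩ := hf.exists_eq_carry_mul ht he hκ
  obtain ⟨n, ψ, hψ⟩ := hφ.exists_eq_carry ht he hκ
  refine ⟨n, fun a b c => β a b c + κ a b * ψ c, fun a b c d => ?_⟩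
  have h := isCocycle2Int_carry hN hκ a b c
  linear_combination hβ a b c d + κ a b * hψ c d - ψ d * h

end Cyclic

/-- The orientation character of the dihedral group, `1` on rotations and `-1` on reflections. -/
def dihedralSign : DihedralGroup 4 → ℤ
  | .r _ => 1
  | .sr _ => -1

/-- The twisted Euler cocycle of the dihedral group of order 8, with values in `ℤ` twisted by
`dihedralSign`: it classifies the infinite dihedral group as an extension of `DihedralGroup 4`. -/
def dihedralEuler : DihedralGroup 4 → DihedralGroup 4 → ℤ
  | .r i, .r j => (i.val + j.val) / 4
  | .r i, .sr j => ((j - i).val - (j.val - i.val)) / 4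
  | .sr i, .r j => ((i + j).val - (i.val + j.val)) / 4
  | .sr i, .sr j => ((j.val - i.val) - (j - i).val) / 4

lemma dihedralSign_mul (g h : DihedralGroup 4) :
    dihedralSign (g * h) = dihedralSign g * dihedralSign h := by
  cases g <;> cases h <;> rfl

lemma dihedralSign_mul_self (g : DihedralGroup 4) : dihedralSign g * dihedralSign g = 1 := by
  cases g <;> rfl

lemma dihedralEuler_cocycle (g h k : DihedralGroup 4) :
    dihedralSign g * dihedralEuler h k - dihedralEuler (g * h) k + dihedralEuler g (h * k) -
      dihedralEuler g h = 0 := by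
  rcases g with i | i <;> rcases h with j | j <;> rcases k with l | l <;>
    revert i j l <;> decide

/-- The cup square of the twisted Euler cocycle is an untwisted 4-cocycle. -/
lemma isCocycle4Int_dihedralEuler_sq :
    IsCocycle4Int fun g h k l =>
      dihedralEuler g h * (dihedralSign (g * h) * dihedralEuler k l) := by
  intro g h k l m
  have h₁ := dihedralEuler_cocycle g h k
  have h₂ := dihedralEuler_cocycle k l m
  simp only [dihedralSign_mul]
  have hg := dihedralSign_mul_self g
  linear_combination
    dihedralSign g * dihedralSign h * dihedralSign k * dihedralEuler l m * h₁ +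
    dihedralEuler g h * dihedralSign g * dihedralSign h * h₂ -
    dihedralEuler h k * dihedralSign h * dihedralSign k * dihedralEuler l m * hg

/-- The exponent of a rotation. -/
def rotationExponent : DihedralGroup 4 → ℕ
  | .r i => i.val
  | .sr _ => 0

lemma exists_eq_r_of_mem_zpowers {g : DihedralGroup 4}
    (hg : g ∈ Subgroup.zpowers (DihedralGroup.r 1 : DihedralGroup 4)) :
    ∃ i, g = DihedralGroup.r i := by
  obtain ⟨k, rfl⟩ := Subgroup.mem_zpowers_iff.mp hg
  exact ⟨k, by simp⟩

/-- The restriction map `H⁴(D₈, ℤ) → H⁴(C, ℤ)` to the cyclic subgroup `C` of order 4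
is surjective: every 4-cocycle on `C` agrees, up to a coboundary on `C`, with the
restriction of a 4-cocycle on `D₈`. -/
theorem stmt_11 :
    ∀ f : (Subgroup.zpowers (DihedralGroup.r 1 : DihedralGroup 4)) →
        (Subgroup.zpowers (DihedralGroup.r 1 : DihedralGroup 4)) →
        (Subgroup.zpowers (DihedralGroup.r 1 : DihedralGroup 4)) →
        (Subgroup.zpowers (DihedralGroup.r 1 : DihedralGroup 4)) → ℤ,
      IsCocycle4Int f →
      ∃ F : DihedralGroup 4 → DihedralGroup 4 → DihedralGroup 4 → DihedralGroup 4 → ℤ,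
        IsCocycle4Int F ∧
        ∃ β : (Subgroup.zpowers (DihedralGroup.r 1 : DihedralGroup 4)) →
            (Subgroup.zpowers (DihedralGroup.r 1 : DihedralGroup 4)) →
            (Subgroup.zpowers (DihedralGroup.r 1 : DihedralGroup 4)) → ℤ,
          ∀ a b c d : (Subgroup.zpowers (DihedralGroup.r 1 : DihedralGroup 4)),
            F ↑a ↑b ↑c ↑d - f a b c d =
              β b c d - β (a * b) c d + β a (b * c) d - β a b (c * d) + β a b c := by
  intro f hf
  have hexp : ∀ i j : ZMod 4, i.val + j.val = (i + j).val + 4 * ((i.val + j.val) / 4) := by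
    decide
  obtain ⟨n, β, hβ⟩ := hf.exists_eq_carry_mul_carry
    (G := Subgroup.zpowers (DihedralGroup.r 1 : DihedralGroup 4)) (N := 4)
    (t := ⟨DihedralGroup.r 1, Subgroup.mem_zpowers _⟩)
    (e := fun a => rotationExponent a)
    (κ := fun a b => (rotationExponent a + rotationExponent b) / 4)
    (by norm_num) (Subtype.ext (by decide))
    (by
      rintro ⟨a, ha⟩
      obtain ⟨i, rfl⟩ := exists_eq_r_of_mem_zpowers ha
      exact Subtype.ext (by simp [rotationExponent]))
    (by
      rintro ⟨a, ha⟩ ⟨b, hb⟩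
      obtain ⟨i, rfl⟩ := exists_eq_r_of_mem_zpowers ha
      obtain ⟨j, rfl⟩ := exists_eq_r_of_mem_zpowers hb
      exact hexp i j)
  refine ⟨fun g h k l => n * (dihedralEuler g h * (dihedralSign (g * h) * dihedralEuler k l)),
    fun g h k l m => ?_, fun a b c => -β a b c, fun a b c d => ?_⟩
  · linear_combination n * isCocycle4Int_dihedralEuler_sq g h k l m
  · rw [hβ]
    obtain ⟨i, hi⟩ := exists_eq_r_of_mem_zpowers a.2
    obtain ⟨j, hj⟩ := exists_eq_r_of_mem_zpowers b.2
    obtain ⟨k, hk⟩ := exists_eq_r_of_mem_zpowers c.2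
    obtain ⟨l, hl⟩ := exists_eq_r_of_mem_zpowers d.2
    simp only [hi, hj, hk, hl, rotationExponent, dihedralEuler, DihedralGroup.r_mul_r,
      dihedralSign]
    push_cast
    ring
end
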